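/- Let 0 < α < 1, 0 ≤ σ_2 < 1, c > 0, and let J be the n×n strictly upper triangular matrix with (i,k) entry c·p_{k−i} for i < k, where p_m is the complementary L1 kernel. Let Z_2 = (n^{−σ_2}, (n−1)^{−σ_2}, …, 1^{−σ_2})^T. Then there is a constant C = C(α, σ_2) such that entrywise, for every m ≥ 0, (J^m Z_2)_i ≤ C^m · (Γ(1−σ_2) c^m / Γ(1−σ_2+mα)) · (n+1−i)^{mα−σ_2} for 1 ≤ i ≤ n. -/

import Mathlib

noncomputable def L1a (α : ℝ) (i : ℕ) : ℝ := ((i : ℝ) + 1) ^ (1 - α) - (i : ℝ) ^ (1 - α)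

noncomputable def L1p (α : ℝ) : ℕ → ℝ
  | 0 => 1
  | n + 1 => ∑ j : Fin (n + 1), (L1a α j - L1a α (j + 1)) * L1p α (n - j)

theorem L1a_pos {α : ℝ} (hα1 : α < 1) (j : ℕ) : 0 < L1a α j :=
  sub_pos.2 (Real.rpow_lt_rpow j.cast_nonneg (by linarith) (by linarith))

theorem L1a_zero {α : ℝ} (hα1 : α < 1) : L1a α 0 = 1 := by
  have h : 1 - α ≠ 0 := by linarith
  simp [L1a, Real.zero_rpow h]

theorem le_L1a {α : ℝ} (hα0 : 0 < α) (hα1 : α < 1) (j : ℕ) :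
    (1 - α) * ((j : ℝ) + 1) ^ (-α) ≤ L1a α j := by
  obtain ⟨x, ⟨hx0, hx1⟩, hx⟩ := exists_deriv_eq_slope (fun y : ℝ => y ^ (1 - α))
    (lt_add_one (j : ℝ))
    (Real.continuous_rpow_const (by linarith)).continuousOn
    (fun y hy => (Real.hasDerivAt_rpow_const
      (Or.inl ((j.cast_nonneg.trans_lt hy.1).ne'))).differentiableAt.differentiableWithinAt)
  have hxp : 0 < x := j.cast_nonneg.trans_lt hx0
  rw [(Real.hasDerivAt_rpow_const (Or.inl hxp.ne')).deriv, add_sub_cancel_left, div_one] at hx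
  rw [L1a, ← hx, show 1 - α - 1 = -α by ring]
  exact mul_le_mul_of_nonneg_left
    (Real.rpow_le_rpow_of_nonpos hxp hx1.le (by linarith)) (by linarith)

theorem exists_L1a_succ_eq {α : ℝ} (hα1 : α < 1) (j : ℕ) :
    ∃ x ∈ Set.Ioo (j : ℝ) (j + 1), L1a α (j + 1) = L1a α j * (1 + x⁻¹) ^ (-α) := by
  have hd : ∀ y : ℝ, (j : ℝ) < y → HasDerivAt (fun y : ℝ => y ^ (1 - α))
      ((1 - α) * y ^ (1 - α - 1)) y := fun y hy =>
    Real.hasDerivAt_rpow_const (Or.inl ((j.cast_nonneg.trans_lt hy).ne'))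
  have hd' : ∀ y : ℝ, (j : ℝ) < y → HasDerivAt (fun y : ℝ => (y + 1) ^ (1 - α))
      ((1 - α) * (y + 1) ^ (1 - α - 1)) y := fun y hy =>
    HasDerivAt.comp_add_const y 1 (hd (y + 1) (by linarith))
  have hc : Continuous (fun y : ℝ => y ^ (1 - α)) := Real.continuous_rpow_const (by linarith)
  obtain ⟨x, hx, h⟩ := exists_ratio_hasDerivAt_eq_ratio_slope _ _ (lt_add_one (j : ℝ))
    (hc.comp (continuous_id.add continuous_const)).continuousOn (fun y hy => hd' y hy.1)
    _ _ hc.continuousOn (fun y hy => hd y hy.1)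
  have hxp : 0 < x := j.cast_nonneg.trans_lt hx.1
  refine ⟨x, hx, ?_⟩
  have hxα : x ^ (-α) ≠ 0 := (Real.rpow_pos_of_pos hxp _).ne'
  have hs : 1 - α ≠ 0 := by linarith
  have key : (1 + x⁻¹) ^ (-α) = (x + 1) ^ (-α) / x ^ (-α) := by
    rw [← Real.div_rpow (by linarith) hxp.le]
    congr 1
    field_simp
  rw [key, ← mul_div_assoc, eq_div_iff hxα]
  rw [show 1 - α - 1 = -α by ring] at h
  simp only [Function.comp_apply, Pi.add_apply, id_eq] at h
  apply mul_left_cancel₀ hs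
  simp only [L1a]
  push_cast
  linear_combination -h

theorem L1a_succ_le {α : ℝ} (hα0 : 0 < α) (hα1 : α < 1) (j : ℕ) :
    L1a α (j + 1) ≤ L1a α j := by
  obtain ⟨x, hx, h⟩ := exists_L1a_succ_eq hα1 j
  have hxp : 0 < x := j.cast_nonneg.trans_lt hx.1
  rw [h]
  refine mul_le_of_le_one_right (L1a_pos hα1 j).le
    (Real.rpow_le_one_of_one_le_of_nonpos ?_ (by linarith))
  linarith [inv_pos.2 hxp]

theorem L1a_succ_mul_le {α : ℝ} (hα0 : 0 < α) (hα1 : α < 1) {j l : ℕ} (hjl : j < l) :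
    L1a α (j + 1) * L1a α l ≤ L1a α j * L1a α (l + 1) := by
  obtain ⟨x, hx, h⟩ := exists_L1a_succ_eq hα1 j
  obtain ⟨y, hy, h'⟩ := exists_L1a_succ_eq hα1 l
  have hxp : 0 < x := j.cast_nonneg.trans_lt hx.1
  have hyp : 0 < y := l.cast_nonneg.trans_lt hy.1
  have hxy : x ≤ y := by
    have : (j : ℝ) + 1 ≤ l := by exact_mod_cast hjl
    linarith [hx.2, hy.1]
  have hr : (1 + x⁻¹) ^ (-α) ≤ (1 + y⁻¹) ^ (-α) :=
    Real.rpow_le_rpow_of_nonpos (by positivity) (by gcongr) (by linarith)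
  rw [h, h']
  calc L1a α j * (1 + x⁻¹) ^ (-α) * L1a α l
      = L1a α j * L1a α l * (1 + x⁻¹) ^ (-α) := by ring
    _ ≤ L1a α j * L1a α l * (1 + y⁻¹) ^ (-α) :=
        mul_le_mul_of_nonneg_left hr (mul_pos (L1a_pos hα1 j) (L1a_pos hα1 l)).le
    _ = _ := by ring

theorem L1p_succ (α : ℝ) (n : ℕ) :
    L1p α (n + 1) =
      ∑ j ∈ Finset.range (n + 1), (L1a α j - L1a α (j + 1)) * L1p α (n - j) := by
  rw [L1p, Finset.sum_range]

theorem L1p_nonneg {α : ℝ} (hα0 : 0 < α) (hα1 : α < 1) (n : ℕ) : 0 ≤ L1p α n := by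
  induction n using Nat.strong_induction_on with
  | _ n ih =>
    cases n with
    | zero => simp [L1p]
    | succ n =>
      rw [L1p_succ]
      exact Finset.sum_nonneg fun j _ => mul_nonneg
        (sub_nonneg.2 (L1a_succ_le hα0 hα1 j)) (ih _ (by omega))

theorem sum_L1a_mul_L1p {α : ℝ} (hα1 : α < 1) (m : ℕ) :
    ∑ j ∈ Finset.range (m + 1), L1a α (m - j) * L1p α j = 1 := by
  rw [← Finset.sum_range_reflect]
  have h : ∀ m, ∑ j ∈ Finset.range (m + 1), L1a α j * L1p α (m - j) = 1 := by
    intro m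
    induction m with
    | zero => simp [L1a_zero hα1, L1p]
    | succ m ih =>
      rw [Finset.sum_range_succ', L1a_zero hα1, one_mul, Nat.sub_zero, L1p_succ,
        ← Finset.sum_add_distrib, ← ih]
      refine Finset.sum_congr rfl fun j _ => ?_
      rw [Nat.add_sub_add_right]
      ring
  rw [← h m]
  refine Finset.sum_congr rfl fun j hj => ?_
  rw [Finset.mem_range] at hj
  rw [show m - (m + 1 - 1 - j) = j by omega, Nat.add_sub_cancel]

theorem sum_L1a_mul_L1p_sub {α : ℝ} (hα1 : α < 1) (m : ℕ) :
    ∑ j ∈ Finset.range (m + 1), L1a α (m - j) * (L1p α j - L1p α (j + 1)) = L1a α (m + 1) := by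
  have h := sum_L1a_mul_L1p hα1 (m + 1)
  rw [Finset.sum_range_succ'] at h
  simp only [Nat.add_sub_add_right, Nat.sub_zero] at h
  simp only [mul_sub, Finset.sum_sub_distrib]
  rw [sum_L1a_mul_L1p hα1 m, ← h, L1p]
  ring

/-- The complementary kernel is nonincreasing, a form of Kaluza's theorem for the log-convex
sequence `L1a α`. -/
theorem L1p_succ_le {α : ℝ} (hα0 : 0 < α) (hα1 : α < 1) (m : ℕ) :
    L1p α (m + 1) ≤ L1p α m := by
  rw [← sub_nonneg]
  induction m using Nat.strong_induction_on with
  | _ m ih =>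
    cases m with
    | zero =>
      have h := sum_L1a_mul_L1p_sub hα1 0
      simp only [zero_add, Finset.sum_range_one, Nat.sub_zero, L1a_zero hα1, one_mul] at h
      rw [zero_add, h]
      exact (L1a_pos hα1 1).le
    | succ m =>
      have h0 := sum_L1a_mul_L1p_sub hα1 m
      have h1 := sum_L1a_mul_L1p_sub hα1 (m + 1)
      rw [Finset.sum_range_succ, Nat.sub_self, L1a_zero hα1, one_mul] at h1
      refine nonneg_of_mul_nonneg_right (a := L1a α (m + 1)) ?_ (L1a_pos hα1 _)
      have h2 : L1a α (m + 1) * (L1p α (m + 1) - L1p α (m + 1 + 1)) =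
          ∑ j ∈ Finset.range (m + 1), (L1a α (m + 2) * L1a α (m - j)
            - L1a α (m + 1) * L1a α (m + 1 - j)) * (L1p α j - L1p α (j + 1)) := by
        simp only [sub_mul _ _ (_ - _), Finset.sum_sub_distrib, mul_assoc, ← Finset.mul_sum]
        rw [h0]
        linear_combination L1a α (m + 1) * h1
      rw [h2]
      refine Finset.sum_nonneg fun j hj => ?_
      have hj' : j < m + 1 := Finset.mem_range.1 hj
      refine mul_nonneg ?_ (ih j hj')
      have h3 := L1a_succ_mul_le hα0 hα1 (j := m - j) (l := m + 1) (by omega)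
      rw [show m - j + 1 = m + 1 - j by omega] at h3
      linarith

theorem L1p_le {α : ℝ} (hα0 : 0 < α) (hα1 : α < 1) {m : ℕ} (hm : 0 < m) :
    L1p α m ≤ (1 - α)⁻¹ * (m : ℝ) ^ (α - 1) := by
  have hanti : Antitone (L1p α) := antitone_nat_of_succ_le (L1p_succ_le hα0 hα1)
  have hantia : Antitone (L1a α) := antitone_nat_of_succ_le (L1a_succ_le hα0 hα1)
  have hp := L1p_nonneg hα0 hα1 m
  have hs : 0 < 1 - α := by linarith
  have h1 : ((m : ℝ) + 1) * (L1a α m * L1p α m) ≤ 1 := by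
    have := Finset.card_nsmul_le_sum (Finset.range (m + 1))
      (fun j => L1a α (m - j) * L1p α j) (L1a α m * L1p α m) (fun j hj =>
        mul_le_mul (hantia (Nat.sub_le _ _)) (hanti (Nat.lt_succ_iff.1 (Finset.mem_range.1 hj)))
          hp (L1a_pos hα1 _).le)
    rw [sum_L1a_mul_L1p hα1 m] at this
    simpa [nsmul_eq_mul] using this
  have hm1 : (0 : ℝ) < (m : ℝ) + 1 := by positivity
  have h2 : (1 - α) * ((m : ℝ) + 1) ^ (1 - α) * L1p α m ≤ 1 := by
    refine le_trans ?_ h1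
    rw [show (1 : ℝ) - α = 1 + -α by ring, Real.rpow_add hm1, Real.rpow_one]
    have := mul_le_mul_of_nonneg_right (le_L1a hα0 hα1 m) (mul_nonneg hm1.le hp)
    linarith
  have h3 : (1 - α) * (m : ℝ) ^ (1 - α) * L1p α m ≤ 1 := by
    refine le_trans ?_ h2
    gcongr
    linarith
  have hmp : (0 : ℝ) < (m : ℝ) ^ (1 - α) := Real.rpow_pos_of_pos (by exact_mod_cast hm) _
  rw [show α - 1 = -(1 - α) by ring, Real.rpow_neg m.cast_nonneg, ← mul_inv,
    ← one_div, le_div_iff₀ (by positivity)]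
  linarith

theorem integral_rpow_mul_sub_rpow {s t a : ℝ} (hs : 0 < s) (ht : 0 < t) (ha : 0 < a) :
    ∫ x in (0 : ℝ)..a, x ^ (s - 1) * (a - x) ^ (t - 1)
      = a ^ (s + t - 1) * ProbabilityTheory.beta s t := by
  have hb : Complex.betaIntegral s t = (ProbabilityTheory.beta s t : ℂ) := by
    rw [Complex.betaIntegral_eq_Gamma_mul_div _ _ (by simpa) (by simpa), ProbabilityTheory.beta]
    push_cast [Complex.Gamma_ofReal]
    rw [← Complex.ofReal_add, Complex.Gamma_ofReal]
  have h := Complex.betaIntegral_scaled s t ha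
  rw [hb] at h
  apply Complex.ofReal_injective
  rw [← intervalIntegral.integral_ofReal]
  push_cast [Complex.ofReal_cpow ha.le]
  rw [← h]
  refine intervalIntegral.integral_congr fun x hx => ?_
  rw [Set.uIcc_of_le ha.le] at hx
  rw [Complex.ofReal_cpow hx.1, Complex.ofReal_cpow (sub_nonneg.2 hx.2)]
  push_cast
  rfl

/-- The beta integrand `x ^ b * (a - x) ^ d` with `d ≤ 0` has no strict interior local maximum. -/
theorem rpow_mul_sub_rpow_quasiconvex {a b d y : ℝ} (hd : d ≤ 0) (hy0 : 0 < y) (hya : y < a) :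
    (∀ x, 0 < x → x < y → y ^ b * (a - y) ^ d ≤ x ^ b * (a - x) ^ d) ∨
      ∀ x, y < x → x < a → y ^ b * (a - y) ^ d ≤ x ^ b * (a - x) ^ d := by
  rcases le_total 0 b with hb | hb
  · right
    intro x hyx hxa
    exact mul_le_mul (Real.rpow_le_rpow hy0.le hyx.le hb)
      (Real.rpow_le_rpow_of_nonpos (by linarith) (by linarith) hd)
      (Real.rpow_nonneg (by linarith) _) (Real.rpow_nonneg (by linarith) _)
  · have hlog : ∀ u v : ℝ, 0 < u → 0 < v → Real.log v - Real.log u ≤ (v - u) / u := by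
      intro u v hu hv
      rw [← Real.log_div hv.ne' hu.ne', sub_div, div_self hu.ne']
      exact Real.log_le_sub_one_of_pos (div_pos hv hu)
    have key : ∀ x, 0 < x → x < a → 0 ≤ (x - y) * (b / y - d / (a - y)) →
        y ^ b * (a - y) ^ d ≤ x ^ b * (a - x) ^ d := by
      intro x hx0 hxa h
      have hay : 0 < a - y := by linarith
      have hax : 0 < a - x := by linarith
      rw [Real.rpow_def_of_pos hy0, Real.rpow_def_of_pos hay, Real.rpow_def_of_pos hx0,
        Real.rpow_def_of_pos hax, ← Real.exp_add, ← Real.exp_add, Real.exp_le_exp]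
      have h1 := mul_le_mul_of_nonpos_left (hlog y x hy0 hx0) hb
      have h2 := mul_le_mul_of_nonpos_left (hlog (a - y) (a - x) hay hax) hd
      have h3 : (x - y) * (b / y - d / (a - y)) =
          b * ((x - y) / y) + d * ((a - x - (a - y)) / (a - y)) := by ring
      linarith
    rcases le_total 0 (b / y - d / (a - y)) with h | h
    · right
      intro x hyx hxa
      exact key x (by linarith) hxa (mul_nonneg (by linarith) h)
    · left
      intro x hx0 hxy
      exact key x hx0 (by linarith) (mul_nonneg_of_nonpos_of_nonpos (by linarith) h)

theorem sum_rpow_mul_sub_rpow_le {s t : ℝ} (hs : 0 < s) (ht : 0 < t) (ht1 : t ≤ 1) (K : ℕ) :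
    ∑ r ∈ Finset.range K,
        ((r : ℝ) + 1) ^ (s - 1) * (((K : ℝ) + 1) - ((r : ℝ) + 1)) ^ (t - 1)
      ≤ 2 * (((K : ℝ) + 1) ^ (s + t - 1) * ProbabilityTheory.beta s t) := by
  set a : ℝ := (K : ℝ) + 1 with ha
  have ha0 : 0 < a := by positivity
  set f : ℝ → ℝ := fun x => x ^ (s - 1) * (a - x) ^ (t - 1) with hf
  have hint := integral_rpow_mul_sub_rpow hs ht ha0
  have hi : IntervalIntegrable f MeasureTheory.volume 0 a := by
    refine intervalIntegral.intervalIntegrable_of_integral_ne_zero ?_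
    rw [hint]
    exact (mul_pos (Real.rpow_pos_of_pos ha0 _) (ProbabilityTheory.beta_pos hs ht)).ne'
  have hsub : ∀ i : ℕ, i < K + 1 →
      IntervalIntegrable f MeasureTheory.volume (i : ℝ) ((i + 1 : ℕ) : ℝ) := by
    intro i hik
    have : ((i + 1 : ℕ) : ℝ) ≤ a := by rw [ha]; exact_mod_cast hik
    refine hi.mono_set ?_
    rw [Set.uIcc_of_le (by push_cast; linarith), Set.uIcc_of_le ha0.le]
    exact Set.Icc_subset_Icc i.cast_nonneg this
  set I : ℕ → ℝ := fun i => ∫ x in (i : ℝ)..((i + 1 : ℕ) : ℝ), f x with hI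
  have hsum : ∑ i ∈ Finset.range (K + 1), I i = a ^ (s + t - 1) * ProbabilityTheory.beta s t := by
    rw [hI, intervalIntegral.sum_integral_adjacent_intervals (a := fun i : ℕ => (i : ℝ)) hsub,
      ← hint, ha]
    push_cast
    rfl
  have hle : ∀ (i : ℕ) (v : ℝ), i < K + 1 → (∀ x ∈ Set.Ioo (i : ℝ) ((i + 1 : ℕ) : ℝ), v ≤ f x) →
      v ≤ I i := by
    intro i v hik hv
    have := intervalIntegral.integral_mono_on_of_le_Ioo (by push_cast; linarith)
      intervalIntegrable_const (hsub i hik) hv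
    simpa [hI] using this
  have hmem : ∀ i : ℕ, i < K + 1 → ∀ x ∈ Set.Ioo (i : ℝ) ((i + 1 : ℕ) : ℝ), 0 < x ∧ x < a := by
    intro i hik x hx
    have : ((i + 1 : ℕ) : ℝ) ≤ a := by rw [ha]; exact_mod_cast hik
    exact ⟨i.cast_nonneg.trans_lt hx.1, hx.2.trans_le this⟩
  have hI0 : ∀ i : ℕ, i < K + 1 → 0 ≤ I i := fun i hik => hle i 0 hik fun x hx =>
    mul_nonneg (Real.rpow_nonneg (hmem i hik x hx).1.le _)
      (Real.rpow_nonneg (sub_nonneg.2 (hmem i hik x hx).2.le) _)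
  have hterm : ∀ r ∈ Finset.range K, f ((r : ℝ) + 1) ≤ I r + I (r + 1) := by
    intro r hr
    have hrK : r < K := Finset.mem_range.1 hr
    have hra : (r : ℝ) + 1 < a := by
      have : (r : ℝ) < K := by exact_mod_cast hrK
      linarith
    have h0 := hI0 r (by omega)
    have h1 := hI0 (r + 1) (by omega)
    rcases rpow_mul_sub_rpow_quasiconvex (b := s - 1) (sub_nonpos.2 ht1)
      (by positivity : (0 : ℝ) < (r : ℝ) + 1) hra with h | h
    · have := hle r (f ((r : ℝ) + 1)) (by omega) fun x hx =>
        h x (hmem r (by omega) x hx).1 (by simpa using hx.2)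
      linarith
    · have := hle (r + 1) (f ((r : ℝ) + 1)) (by omega) fun x hx =>
        h x (by simpa using hx.1) (hmem (r + 1) (by omega) x hx).2
      linarith
  have hA : ∑ i ∈ Finset.range K, I i ≤ ∑ i ∈ Finset.range (K + 1), I i := by
    rw [Finset.sum_range_succ]
    linarith [hI0 K (by omega)]
  have hB : ∑ i ∈ Finset.range K, I (i + 1) ≤ ∑ i ∈ Finset.range (K + 1), I i := by
    rw [Finset.sum_range_succ']
    linarith [hI0 0 (by omega)]
  calc _ ≤ ∑ r ∈ Finset.range K, (I r + I (r + 1)) := Finset.sum_le_sum hterm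
    _ ≤ _ := by rw [Finset.sum_add_distrib]; linarith

theorem sum_L1p_mul_rpow_le {α s : ℝ} (hα0 : 0 < α) (hα1 : α < 1) (hs : 0 < s) (K : ℕ) :
    ∑ r ∈ Finset.range K, L1p α (K - r) * ((r : ℝ) + 1) ^ (s - 1)
      ≤ 2 * Real.Gamma α / (1 - α) * (Real.Gamma s / Real.Gamma (s + α))
        * ((K : ℝ) + 1) ^ (s + α - 1) := by
  have hα : 0 < 1 - α := by linarith
  calc ∑ r ∈ Finset.range K, L1p α (K - r) * ((r : ℝ) + 1) ^ (s - 1)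
      ≤ ∑ r ∈ Finset.range K, (1 - α)⁻¹ * (((r : ℝ) + 1) ^ (s - 1)
          * (((K : ℝ) + 1) - ((r : ℝ) + 1)) ^ (α - 1)) := by
        refine Finset.sum_le_sum fun r hr => ?_
        have hrK : r < K := Finset.mem_range.1 hr
        have h := mul_le_mul_of_nonneg_right (L1p_le hα0 hα1 (Nat.sub_pos_of_lt hrK))
          (Real.rpow_nonneg (by positivity : (0 : ℝ) ≤ (r : ℝ) + 1) (s - 1))
        rw [Nat.cast_sub hrK.le] at h
        rw [add_sub_add_right_eq_sub]
        linarith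
    _ ≤ (1 - α)⁻¹ * (2 * (((K : ℝ) + 1) ^ (s + α - 1) * ProbabilityTheory.beta s α)) := by
        rw [← Finset.mul_sum]
        exact mul_le_mul_of_nonneg_left (sum_rpow_mul_sub_rpow_le hs hα0 hα1.le K)
          (inv_nonneg.2 hα.le)
    _ = _ := by
        rw [ProbabilityTheory.beta]
        ring

/-- A row of a strictly upper triangular Toeplitz matrix, indexed from the last column. -/
theorem sum_fin_ite_lt_eq_sum_range {n : ℕ} (i : Fin n) (q g : ℕ → ℝ) :
    ∑ k : Fin n, (if (i : ℕ) < (k : ℕ) then q ((k : ℕ) - (i : ℕ)) else 0) * g (n - k)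
      = ∑ r ∈ Finset.range (n - 1 - i), q (n - 1 - i - r) * g (r + 1) := by
  rw [Fin.sum_univ_eq_sum_range
    (fun k => (if (i : ℕ) < k then q (k - (i : ℕ)) else 0) * g (n - k)) n,
    ← Finset.sum_range_reflect]
  have hi := i.isLt
  symm
  refine Finset.sum_subset_zero_on_sdiff (Finset.range_subset_range.2 (by omega)) ?_ ?_
  · intro r hr
    simp only [Finset.mem_sdiff, Finset.mem_range] at hr
    rw [if_neg (by omega), zero_mul]
  · intro r hr
    rw [Finset.mem_range] at hr
    rw [if_pos (by omega)]
    congr 2 <;> omega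

theorem L1_matrix_power_bound (α σ₂ : ℝ) (hα0 : 0 < α) (hα1 : α < 1)
    (hσ₂0 : 0 ≤ σ₂) (hσ₂1 : σ₂ < 1) :
    ∃ C : ℝ, 0 < C ∧ ∀ (n : ℕ) (c : ℝ), 0 < c →
      ∀ (J : Matrix (Fin n) (Fin n) ℝ),
      (∀ i k : Fin n, J i k =
        if (i : ℕ) < (k : ℕ) then c * L1p α ((k : ℕ) - (i : ℕ)) else 0) →
      ∀ (Z₂ : Fin n → ℝ), (∀ i : Fin n, Z₂ i = ((n : ℝ) - (i : ℕ)) ^ (-σ₂)) →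
      ∀ m : ℕ, ∀ i : Fin n,
        (J ^ m).mulVec Z₂ i
          ≤ C ^ m * (Real.Gamma (1 - σ₂) * c ^ m / Real.Gamma (1 - σ₂ + (m : ℝ) * α))
            * ((n : ℝ) - (i : ℕ)) ^ ((m : ℝ) * α - σ₂) := by
  have hα : 0 < 1 - α := by linarith
  have hC : 0 < 2 * Real.Gamma α / (1 - α) := by
    have := Real.Gamma_pos_of_pos hα0
    positivity
  set C := 2 * Real.Gamma α / (1 - α)
  refine ⟨C, hC, ?_⟩
  intro n c hc J hJ Z₂ hZ m
  induction m with
  | zero =>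
    intro i
    have := Real.Gamma_pos_of_pos (sub_pos.2 hσ₂1)
    simp [hZ, this.ne']
  | succ m ih =>
    intro i
    have hi := i.isLt
    set s : ℝ := 1 - σ₂ + (m : ℝ) * α with hs
    have hs0 : 0 < s := by
      have : 0 ≤ (m : ℝ) * α := by positivity
      linarith
    have hΓs := Real.Gamma_pos_of_pos hs0
    set B : ℝ := C ^ m * (Real.Gamma (1 - σ₂) * c ^ m / Real.Gamma s) with hB
    have hB0 : 0 ≤ B := by
      have := Real.Gamma_pos_of_pos (sub_pos.2 hσ₂1)
      positivity
    have hcast : ∀ k : Fin n, (n : ℝ) - (k : ℕ) = ((n - k : ℕ) : ℝ) := fun k =>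
      (Nat.cast_sub k.isLt.le).symm
    have hexp : (m : ℝ) * α - σ₂ = s - 1 := by rw [hs]; ring
    have hstep : (J ^ (m + 1)).mulVec Z₂ i ≤
        ∑ k : Fin n, (if (i : ℕ) < (k : ℕ) then L1p α ((k : ℕ) - (i : ℕ)) else 0)
          * (c * B * ((n - k : ℕ) : ℝ) ^ (s - 1)) := by
      rw [pow_succ', ← Matrix.mulVec_mulVec, Matrix.mulVec, dotProduct]
      refine Finset.sum_le_sum fun k _ => ?_
      have hk := ih k
      rw [hexp, hcast] at hk
      rw [hJ]
      split_ifs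
      · have := mul_le_mul_of_nonneg_left hk
          (mul_nonneg hc.le (L1p_nonneg hα0 hα1 ((k : ℕ) - (i : ℕ))))
        linarith
      · simp
    rw [sum_fin_ite_lt_eq_sum_range i (L1p α) (fun r => c * B * (r : ℝ) ^ (s - 1))] at hstep
    have hsum := sum_L1p_mul_rpow_le hα0 hα1 hs0 (n - 1 - i)
    have hK : ((n - 1 - i : ℕ) : ℝ) + 1 = (n : ℝ) - (i : ℕ) := by
      rw [hcast]
      exact_mod_cast (by omega : n - 1 - (i : ℕ) + 1 = n - i)
    rw [hK] at hsum
    have hs' : 1 - σ₂ + ((m + 1 : ℕ) : ℝ) * α = s + α := by rw [hs]; push_cast; ring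
    have he' : ((m + 1 : ℕ) : ℝ) * α - σ₂ = s + α - 1 := by rw [hs]; push_cast; ring
    rw [hs', he']
    calc _ ≤ _ := hstep
      _ = c * B * ∑ r ∈ Finset.range (n - 1 - i),
            L1p α (n - 1 - i - r) * ((r : ℝ) + 1) ^ (s - 1) := by
          rw [Finset.mul_sum]
          refine Finset.sum_congr rfl fun r _ => ?_
          push_cast
          ring
      _ ≤ c * B * (C * (Real.Gamma s / Real.Gamma (s + α))
            * ((n : ℝ) - (i : ℕ)) ^ (s + α - 1)) :=
          mul_le_mul_of_nonneg_left hsum (mul_nonneg hc.le hB0)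
      _ = _ := by
          rw [hB]
          field_simp
          ring
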